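/- Let p ∈ [−1,1]⁷ satisfy g₁(p) = g₂(p) = g₃(p) = g₄(p) = g₅(p) = g₆(p) = g₇(p) = 0, where g₁,…,g₇ are the seven generating polynomials of the ideal 𝒳. Then there exists (t₁,t₂,t₃) ∈ ℝ³ with p = Π₃(t₁,t₂,t₃). -/

import Mathlib

open Real

noncomputable section

/-- Coordinates on `ℝ⁷` are `(x₁,x₂,x₃,x₁₂,x₁₃,x₂₃,x₁₂₃)`, indexed `0,…,6`. -/
abbrev R7 := Fin 7 → ℝ

/-- `Π₃(t₁,t₂,t₃)`. -/
def Pi3 (t₁ t₂ t₃ : ℝ) : R7 :=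
  ![Real.cos (2 * π * t₁), Real.cos (2 * π * t₂), Real.cos (2 * π * t₃),
    Real.cos (2 * π * (t₁ + t₂)), Real.cos (2 * π * (t₁ + t₃)),
    Real.cos (2 * π * (t₂ + t₃)), Real.cos (2 * π * (t₁ + t₂ + t₃))]

def g1 (p : R7) : ℝ := p 2 ^ 2 - 2 * p 2 * p 3 * p 6 + p 3 ^ 2 + p 6 ^ 2 - 1
def g2 (p : R7) : ℝ := p 1 ^ 2 - 2 * p 1 * p 4 * p 6 + p 4 ^ 2 + p 6 ^ 2 - 1
def g3 (p : R7) : ℝ :=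
  p 1 * p 2 * p 6 ^ 2 - (1/2) * p 1 * p 2 - (1/2) * p 1 * p 3 * p 6
    - (1/2) * p 2 * p 4 * p 6 + (1/2) * p 3 * p 4 - (1/2) * p 5 * p 6 ^ 2
    + (1/2) * p 5
def g4 (p : R7) : ℝ :=
  p 0 + 2 * p 1 * p 2 * p 6 - p 1 * p 3 - p 2 * p 4 - p 5 * p 6
def g5 (p : R7) : ℝ :=
  p 1 * p 3 * p 5 - 2 * p 1 * p 4 * p 6 ^ 2 + p 1 * p 4 + 2 * p 2 * p 3 * p 6 ^ 2
    - p 2 * p 3 - p 2 * p 4 * p 5 - p 3 ^ 2 * p 6 + p 4 ^ 2 * p 6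
def g6 (p : R7) : ℝ :=
  p 1 * p 2 * p 3 - 2 * p 1 * p 6 ^ 3 + p 1 * p 6 - p 2 * p 5 * p 6
    - p 3 ^ 2 * p 4 + 2 * p 3 * p 5 * p 6 ^ 2 - p 3 * p 5 + p 4 * p 6 ^ 2
def g7 (p : R7) : ℝ :=
  p 1 * p 2 * p 5 - p 1 * p 4 * p 6 - p 2 * p 3 * p 6 + (1/2) * p 3 ^ 2
    + (1/2) * p 4 ^ 2 - (1/2) * p 5 ^ 2 + p 6 ^ 2 - 1/2

lemma exists_angle (a u S : ℝ) (ha : -1 ≤ a) (ha' : a ≤ 1) (h : u ^ 2 = (1 - a ^ 2) * S ^ 2) :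
    ∃ α : ℝ, Real.cos α = a ∧ u = Real.sin α * S := by
  have hc := Real.cos_arccos ha ha'
  have hs := Real.sin_sq_add_cos_sq (Real.arccos a)
  rw [hc] at hs
  have hf : (u - Real.sin (Real.arccos a) * S) * (u + Real.sin (Real.arccos a) * S) = 0 := by
    linear_combination h - S ^ 2 * hs
  rcases mul_eq_zero.mp hf with h | h
  · exact ⟨_, hc, by linarith⟩
  · exact ⟨-Real.arccos a, by rw [Real.cos_neg, hc], by rw [Real.sin_neg]; linarith⟩

lemma finish (p : R7) (θ α β : ℝ) (h0 : p 0 = Real.cos (α + β - θ)) (h1 : p 1 = Real.cos (θ - β))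
    (h2 : p 2 = Real.cos (θ - α)) (h3 : p 3 = Real.cos α) (h4 : p 4 = Real.cos β)
    (h5 : p 5 = Real.cos (2 * θ - α - β)) (h6 : p 6 = Real.cos θ) :
    ∃ t₁ t₂ t₃ : ℝ, p = Pi3 t₁ t₂ t₃ := by
  have hp : (2 * π) ≠ 0 := by positivity
  refine ⟨(α + β - θ) / (2 * π), (θ - β) / (2 * π), (θ - α) / (2 * π), ?_⟩
  ext i
  fin_cases i <;> simp only [Pi3, ← add_div, mul_div_cancel₀ _ hp]
  · exact h0
  · exact h1
  · exact h2
  · refine h3.trans ?_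
    show _ = Real.cos _
    congr 1; ring
  · refine h4.trans ?_
    show _ = Real.cos _
    congr 1; ring
  · refine h5.trans ?_
    show _ = Real.cos _
    congr 1; ring
  · refine h6.trans ?_
    show _ = Real.cos _
    congr 1; ring

theorem stmt13 (p : R7) (hbox : ∀ i, p i ∈ Set.Icc (-1 : ℝ) 1)
    (h1 : g1 p = 0) (h2 : g2 p = 0) (h3 : g3 p = 0) (h4 : g4 p = 0)
    (h5 : g5 p = 0) (h6 : g6 p = 0) (h7 : g7 p = 0) :
    ∃ t₁ t₂ t₃ : ℝ, p = Pi3 t₁ t₂ t₃ := by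
  simp only [g1, g2, g3, g4, g5, g6, g7] at h1 h2 h3 h4 h5 h6 h7
  have hw := Real.cos_arccos (hbox 6).1 (hbox 6).2
  have hs := Real.sin_sq_add_cos_sq (Real.arccos (p 6))
  generalize Real.arccos (p 6) = θ at hw hs
  by_cases hS : Real.sin θ = 0
  · have hw2 : p 6 ^ 2 = 1 := by rw [← hw]; rw [hS] at hs; linarith
    have hz : p 2 = p 3 * p 6 := by
      have : (p 2 - p 3 * p 6) ^ 2 = 0 := by linear_combination h1 + (p 3 ^ 2 - 1) * hw2
      have := pow_eq_zero_iff (two_ne_zero) |>.mp this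
      linarith
    have hy : p 1 = p 4 * p 6 := by
      have : (p 1 - p 4 * p 6) ^ 2 = 0 := by linear_combination h2 + (p 4 ^ 2 - 1) * hw2
      have := pow_eq_zero_iff (two_ne_zero) |>.mp this
      linarith
    have ha := Real.cos_arccos (hbox 3).1 (hbox 3).2
    have hsa := Real.sin_sq_add_cos_sq (Real.arccos (p 3))
    generalize Real.arccos (p 3) = α at ha hsa
    rw [ha] at hsa
    rw [hz, hy] at h7 h4
    obtain ⟨β, hb, hu⟩ := exists_angle (p 4) (p 3 * p 4 - p 5) (Real.sin α) (hbox 4).1 (hbox 4).2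
      (by linear_combination (-2) * h7 - (1 - p 4 ^ 2) * hsa
            + (2 * p 3 * p 4 * p 5 - 2 * p 4 ^ 2 - 2 * p 3 ^ 2 + 2) * hw2)
    have hS2 : Real.sin θ ^ 2 = 0 := by rw [hS]; ring
    apply finish p θ α β
    · rw [Real.cos_sub, Real.cos_add, Real.sin_add, ha, hb, hw, hS]
      linear_combination h4 - p 6 * hu - 2 * p 3 * p 4 * p 6 * hw2
    · rw [Real.cos_sub, hb, hw, hS, hy]; ring
    · rw [Real.cos_sub, ha, hw, hS, hz]; ring
    · exact ha.symm
    · exact hb.symm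
    · rw [sub_sub, Real.cos_sub, Real.cos_add, Real.cos_two_mul, Real.sin_two_mul, ha, hb, hw, hS]
      linear_combination -hu - 2 * (p 3 * p 4 - Real.sin α * Real.sin β) * hw2
    · exact hw.symm
  · rw [hw] at hs
    obtain ⟨α, ha, hu⟩ := exists_angle (p 3) (p 2 - p 3 * p 6) (Real.sin θ) (hbox 3).1 (hbox 3).2
      (by linear_combination h1 - (1 - p 3 ^ 2) * hs)
    obtain ⟨β, hb, hv⟩ := exists_angle (p 4) (p 1 - p 4 * p 6) (Real.sin θ) (hbox 4).1 (hbox 4).2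
      (by linear_combination h2 - (1 - p 4 ^ 2) * hs)
    have hz : p 2 = p 3 * p 6 + Real.sin α * Real.sin θ := by linarith
    have hy : p 1 = p 4 * p 6 + Real.sin β * Real.sin θ := by linarith
    have hC : Real.cos (2 * θ - α - β) = (2 * p 6 ^ 2 - 1) * (p 3 * p 4 - Real.sin α * Real.sin β)
        + 2 * Real.sin θ * p 6 * (Real.sin α * p 4 + p 3 * Real.sin β) := by
      rw [sub_sub, Real.cos_sub, Real.cos_add, Real.sin_add, Real.cos_two_mul, Real.sin_two_mul,
        ha, hb, hw]
    have hw2 : p 6 ^ 2 = 1 - Real.sin θ ^ 2 := by linarith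
    have h5' : p 5 = Real.cos (2 * θ - α - β) := by
      rw [hC]
      apply mul_left_cancel₀ (pow_ne_zero 2 hS)
      rw [hz, hy] at h3
      linear_combination 2 * h3 + (p 5
        - 2 * p 6 * Real.sin θ * (p 3 * Real.sin β + p 4 * Real.sin α)
        - (2 * p 6 ^ 2 - 1) * p 3 * p 4) * hs
    apply finish p θ α β
    · rw [Real.cos_sub, Real.cos_add, Real.sin_add, ha, hb, hw]
      rw [h5', hC, hz, hy] at h4
      linear_combination h4 - 2 * p 6 * Real.sin α * Real.sin β * hs
    · rw [Real.cos_sub, hb, hw, hy]; ring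
    · rw [Real.cos_sub, ha, hw, hz]; ring
    · exact ha.symm
    · exact hb.symm
    · exact h5'
    · exact hw.symm

end
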